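/- arXiv:2310.10600 — 9 statements merged into one kernel-verified Lean document; each statement's English description precedes it below -/
import Mathlib

section
/- Theorem 1 (FNS = FN = AVN = PT). For a no-signaling correlation p on a bipartite Bell scenario, the following are equivalent: (i) there exists a face F of the no-signaling set NS with p ∈ F such that F contains no local correlation; (ii) the local content of p is 0, i.e., q_L^max(p) = 0; (iii) there exists a table of zeros Z that p realizes and that is not LHV-realizable; (iv) there exists a nonlocal game (π, W) with classical value ω_C(π,W) < 1 whose winning probability under p is ω^p(π,W) = 1. -/
open Finset

variable {A B X Y : Type*} [Fintype A] [Fintype B] [Fintype X] [Fintype Y]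
  [DecidableEq A] [DecidableEq B] [DecidableEq X] [DecidableEq Y]

/-- A (bipartite) correlation: nonnegative entries, normalized for each pair of settings. -/
def IsCorrelation (p : A → B → X → Y → ℝ) : Prop :=
  (∀ a b x y, 0 ≤ p a b x y) ∧ (∀ x y, ∑ a, ∑ b, p a b x y = 1)

/-- The no-signaling conditions: Alice's marginal does not depend on Bob's setting and
vice versa. -/
def NoSignaling (p : A → B → X → Y → ℝ) : Prop :=
  (∀ a x y y', ∑ b, p a b x y = ∑ b, p a b x y') ∧
  (∀ b y x x', ∑ a, p a b x y = ∑ a, p a b x' y)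

/-- A no-signaling correlation. -/
def IsNSCorrelation (p : A → B → X → Y → ℝ) : Prop :=
  IsCorrelation p ∧ NoSignaling p

/-- The deterministic local correlation associated to outcome assignments `f`, `g`. -/
def detLocal (f : X → A) (g : Y → B) : A → B → X → Y → ℝ :=
  fun a b x y => (if a = f x then (1:ℝ) else 0) * (if b = g y then (1:ℝ) else 0)

/-- A local correlation: a convex combination of deterministic local correlations. -/
def IsLocal (p : A → B → X → Y → ℝ) : Prop :=
  ∃ μ : (X → A) × (Y → B) → ℝ, (∀ fg, 0 ≤ μ fg) ∧ (∑ fg, μ fg = 1) ∧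
    ∀ a b x y, p a b x y = ∑ fg, μ fg * detLocal fg.1 fg.2 a b x y

/-- The local content `q_L^max` of a correlation: the supremum of the local weight over
all decompositions into a local part and a no-signaling part. -/
noncomputable def localContent (p : A → B → X → Y → ℝ) : ℝ :=
  sSup {q : ℝ | 0 ≤ q ∧ q ≤ 1 ∧ ∃ pL pNL : A → B → X → Y → ℝ,
    IsLocal pL ∧ IsNSCorrelation pNL ∧
    ∀ a b x y, p a b x y = q * pL a b x y + (1 - q) * pNL a b x y}

/-- The winning probability of a correlation `p` in the nonlocal game `(π, W)`. -/
def winProb (p : A → B → X → Y → ℝ) (pi : X → Y → ℝ) (W : A → B → X → Y → Bool) : ℝ :=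
  ∑ a, ∑ b, ∑ x, ∑ y, pi x y * (if W a b x y then (1:ℝ) else 0) * p a b x y

/-- The classical value of a nonlocal game: the maximum winning probability over
deterministic local strategies. -/
noncomputable def classicalValue (pi : X → Y → ℝ) (W : A → B → X → Y → Bool) : ℝ :=
  ⨆ fg : (X → A) × (Y → B), winProb (detLocal fg.1 fg.2) pi W

/-- The set of no-signaling correlations. -/
def NSSet (A B X Y : Type*) [Fintype A] [Fintype B] [Fintype X] [Fintype Y] :
    Set (A → B → X → Y → ℝ) := {p | IsNSCorrelation p}

/-- A face of the no-signaling set: a subset of `NS` that is extreme in `NS`. -/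
def IsFace (F : Set (A → B → X → Y → ℝ)) : Prop :=
  F ⊆ NSSet A B X Y ∧ ∀ p ∈ F, ∀ p₁ ∈ NSSet A B X Y, ∀ p₂ ∈ NSSet A B X Y,
    ∀ t : ℝ, 0 < t → t < 1 →
    (∀ a b x y, p a b x y = t * p₁ a b x y + (1 - t) * p₂ a b x y) →
    p₁ ∈ F ∧ p₂ ∈ F

/-- A correlation `p` realizes a table of zeros `Z` if it vanishes on every entry of `Z`. -/
def Realizes (p : A → B → X → Y → ℝ) (Z : Set (A × B × X × Y)) : Prop :=
  ∀ a b x y, (a, b, x, y) ∈ Z → p a b x y = 0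

/-- A table of zeros is LHV-realizable if some deterministic outcome assignment avoids
all its zeros. -/
def LHVRealizable (Z : Set (A × B × X × Y)) : Prop :=
  ∃ (f : X → A) (g : Y → B), ∀ x y, (f x, g y, x, y) ∉ Z

theorem detLocal_nonneg (f : X → A) (g : Y → B) (a : A) (b : B) (x : X) (y : Y) :
    0 ≤ detLocal f g a b x y := by
  unfold detLocal; positivity

theorem detLocal_apply_self (f : X → A) (g : Y → B) (x : X) (y : Y) :
    detLocal f g (f x) (g y) x y = 1 := by
  simp [detLocal]

theorem detLocal_eq_zero_or {f : X → A} {g : Y → B} (a : A) (b : B) (x : X) (y : Y) :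
    detLocal f g a b x y = 0 ∨ (a = f x ∧ b = g y) := by
  unfold detLocal; split_ifs <;> simp_all

theorem isNSCorrelation_detLocal (f : X → A) (g : Y → B) :
    IsNSCorrelation (detLocal f g) := by
  refine ⟨⟨detLocal_nonneg f g, fun x y => ?_⟩, fun a x y y' => ?_, fun b y x x' => ?_⟩ <;>
    simp [detLocal]

theorem isLocal_detLocal (f : X → A) (g : Y → B) : IsLocal (detLocal f g) := by
  refine ⟨Pi.single (f, g) 1, fun fg => ?_, ?_, fun a b x y => ?_⟩
  · by_cases h : fg = (f, g) <;> simp [h]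
  · simp
  · simp [Pi.single_apply]

/-- A local correlation contains a deterministic local correlation in its support. -/
theorem IsLocal.exists_forall_pos {q : A → B → X → Y → ℝ} (hq : IsLocal q) :
    ∃ (f : X → A) (g : Y → B), ∀ x y, 0 < q (f x) (g y) x y := by
  obtain ⟨μ, h0, h1, h⟩ := hq
  obtain ⟨fg, -, hfg⟩ : ∃ fg ∈ univ, 0 < μ fg :=
    exists_lt_of_sum_lt (by simp [h1])
  refine ⟨fg.1, fg.2, fun x y => ?_⟩
  rw [h]
  refine sum_pos' (fun i _ => mul_nonneg (h0 i) (detLocal_nonneg ..)) ⟨fg, mem_univ _, ?_⟩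
  rwa [detLocal_apply_self, mul_one]

/-- If the support of a no-signaling correlation contains that of a deterministic local one, then
the latter can be split off with positive weight. -/
theorem IsNSCorrelation.exists_eq_detLocal_add [Nonempty X] [Nonempty Y]
    {p : A → B → X → Y → ℝ} (hp : IsNSCorrelation p) {f : X → A} {g : Y → B}
    (h : ∀ x y, 0 < p (f x) (g y) x y) :
    ∃ (t : ℝ) (r : A → B → X → Y → ℝ), 0 < t ∧ t < 1 ∧ IsNSCorrelation r ∧
      ∀ a b x y, p a b x y = t * detLocal f g a b x y + (1 - t) * r a b x y := by
  obtain ⟨m, hm⟩ := Finite.exists_min fun z : X × Y => p (f z.1) (g z.2) z.1 z.2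
  obtain ⟨t, ht0, ht⟩ : ∃ t, 0 < t ∧ t < min (p (f m.1) (g m.2) m.1 m.2) 1 :=
    exists_between (lt_min (h _ _) one_pos)
  obtain ⟨htm, ht1⟩ := lt_min_iff.1 ht
  have hs : 0 < 1 - t := sub_pos.2 ht1
  have hd := isNSCorrelation_detLocal f g
  refine ⟨t, fun a b x y => (p a b x y - t * detLocal f g a b x y) / (1 - t), ht0, ht1,
    ⟨⟨fun a b x y => div_nonneg ?_ hs.le, fun x y => ?_⟩, fun a x y y' => ?_,
      fun b y x x' => ?_⟩, fun a b x y => ?_⟩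
  · rcases detLocal_eq_zero_or (f := f) (g := g) a b x y with h0 | ⟨rfl, rfl⟩
    · simpa [h0] using hp.1.1 a b x y
    · rw [detLocal_apply_self, mul_one, sub_nonneg]
      exact htm.le.trans (hm (x, y))
  · simp only [← sum_div, sum_sub_distrib, ← mul_sum, hp.1.2, hd.1.2]
    rw [mul_one, div_self hs.ne']
  · simp only [← sum_div, sum_sub_distrib, ← mul_sum]
    rw [hp.2.1 a x y y', hd.2.1 a x y y']
  · simp only [← sum_div, sum_sub_distrib, ← mul_sum]
    rw [hp.2.2 b y x x', hd.2.2 b y x x']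
  · field_simp
    ring

/-- Some face containing `p` is free of local correlations exactly when the support of `p` contains
the support of no deterministic local correlation. -/
theorem exists_face_iff [Nonempty X] [Nonempty Y]
    {p : A → B → X → Y → ℝ} (hp : IsNSCorrelation p) :
    (∃ F : Set (A → B → X → Y → ℝ), IsFace F ∧ p ∈ F ∧ ∀ q ∈ F, ¬ IsLocal q) ↔
      ∀ (f : X → A) (g : Y → B), ∃ x y, p (f x) (g y) x y = 0 := by
  constructor
  · rintro ⟨F, hF, hpF, hloc⟩ f g
    by_contra! hne
    obtain ⟨t, r, ht0, ht1, hr, h⟩ := hp.exists_eq_detLocal_add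
      fun x y => (hp.1.1 (f x) (g y) x y).lt_of_ne' (hne x y)
    exact hloc _ (hF.2 p hpF _ (isNSCorrelation_detLocal f g) r hr t ht0 ht1 h).1
      (isLocal_detLocal f g)
  · intro h
    refine ⟨{q | IsNSCorrelation q ∧ ∀ a b x y, p a b x y = 0 → q a b x y = 0},
      ⟨fun q hq => hq.1, ?_⟩, ⟨hp, fun _ _ _ _ => id⟩, ?_⟩
    · rintro q ⟨-, hq⟩ p₁ hp₁ p₂ hp₂ t ht0 ht1 hdec
      have key : ∀ a b x y, p a b x y = 0 → p₁ a b x y = 0 ∧ p₂ a b x y = 0 := by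
        intro a b x y h0
        have hsum := (hdec a b x y).symm.trans (hq a b x y h0)
        have hs : 0 < 1 - t := sub_pos.2 ht1
        rw [add_eq_zero_iff_of_nonneg (mul_nonneg ht0.le (hp₁.1.1 a b x y))
          (mul_nonneg hs.le (hp₂.1.1 a b x y))] at hsum
        simpa [ht0.ne', hs.ne'] using hsum
      exact ⟨⟨hp₁, fun a b x y h0 => (key a b x y h0).1⟩,
        ⟨hp₂, fun a b x y h0 => (key a b x y h0).2⟩⟩
    · rintro q ⟨-, hq⟩ hloc
      obtain ⟨f, g, hpos⟩ := hloc.exists_forall_pos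
      obtain ⟨x, y, h0⟩ := h f g
      exact (hpos x y).ne' (hq _ _ _ _ h0)

theorem localContent_eq_zero_iff [Nonempty X] [Nonempty Y]
    {p : A → B → X → Y → ℝ} (hp : IsNSCorrelation p) :
    localContent p = 0 ↔ ∀ (f : X → A) (g : Y → B), ∃ x y, p (f x) (g y) x y = 0 := by
  constructor
  · intro h0 f g
    by_contra! hne
    obtain ⟨t, r, ht0, ht1, hr, h⟩ := hp.exists_eq_detLocal_add
      fun x y => (hp.1.1 (f x) (g y) x y).lt_of_ne' (hne x y)
    have hle : t ≤ localContent p :=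
      le_csSup ⟨1, fun _ hq => hq.2.1⟩
        ⟨ht0.le, ht1.le, detLocal f g, r, isLocal_detLocal f g, hr, h⟩
    exact ht0.not_ge (hle.trans_eq h0)
  · intro h
    refine le_antisymm (Real.sSup_le ?_ le_rfl) (Real.sSup_nonneg fun q hq => hq.1)
    rintro q ⟨-, hq1, pL, pNL, hL, hNL, hdec⟩
    by_contra! hq
    obtain ⟨f, g, hpos⟩ := hL.exists_forall_pos
    obtain ⟨x, y, h0⟩ := h f g
    have hlt := add_pos_of_pos_of_nonneg (mul_pos hq (hpos x y))
      (mul_nonneg (sub_nonneg.2 hq1) (hNL.1.1 (f x) (g y) x y))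
    rw [← hdec, h0] at hlt
    exact hlt.false

theorem exists_not_lhvRealizable_iff {p : A → B → X → Y → ℝ} :
    (∃ Z : Set (A × B × X × Y), Realizes p Z ∧ ¬ LHVRealizable Z) ↔
      ∀ (f : X → A) (g : Y → B), ∃ x y, p (f x) (g y) x y = 0 := by
  constructor
  · rintro ⟨Z, hZ, hn⟩ f g
    by_contra! hne
    exact hn ⟨f, g, fun x y hmem => hne x y (hZ _ _ _ _ hmem)⟩
  · refine fun h => ⟨{z | p z.1 z.2.1 z.2.2.1 z.2.2.2 = 0}, fun _ _ _ _ => id, ?_⟩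
    rintro ⟨f, g, hfg⟩
    obtain ⟨x, y, h0⟩ := h f g
    exact hfg x y h0

theorem winProb_add_winProb_not {p : A → B → X → Y → ℝ} (hp : IsCorrelation p)
    (pi : X → Y → ℝ) (W : A → B → X → Y → Bool) :
    winProb p pi W + winProb p pi (fun a b x y => !W a b x y) = ∑ x, ∑ y, pi x y := by
  have hW : ∀ a b x y, pi x y * (if W a b x y then (1 : ℝ) else 0) * p a b x y +
      pi x y * (if !W a b x y then (1 : ℝ) else 0) * p a b x y = pi x y * p a b x y := by
    intro a b x y
    cases W a b x y <;> simp
  simp only [winProb, ← sum_add_distrib, hW]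
  calc ∑ a, ∑ b, ∑ x, ∑ y, pi x y * p a b x y
      = ∑ w : A × B, ∑ z : X × Y, pi z.1 z.2 * p w.1 w.2 z.1 z.2 := by
        simp only [Fintype.sum_prod_type]
    _ = ∑ z : X × Y, ∑ w : A × B, pi z.1 z.2 * p w.1 w.2 z.1 z.2 := sum_comm
    _ = ∑ x, ∑ y, pi x y := by
        simp only [← mul_sum, Fintype.sum_prod_type, hp.2, mul_one]

theorem winProb_nonneg {p : A → B → X → Y → ℝ} (hp : IsCorrelation p) {pi : X → Y → ℝ}
    (hpi : ∀ x y, 0 ≤ pi x y) (W : A → B → X → Y → Bool) : 0 ≤ winProb p pi W :=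
  sum_nonneg fun a _ => sum_nonneg fun b _ => sum_nonneg fun x _ => sum_nonneg fun y _ =>
    mul_nonneg (mul_nonneg (hpi x y) (by positivity)) (hp.1 a b x y)

theorem winProb_eq_zero_iff {p : A → B → X → Y → ℝ} (hp : IsCorrelation p) {pi : X → Y → ℝ}
    (hpi : ∀ x y, 0 ≤ pi x y) (W : A → B → X → Y → Bool) :
    winProb p pi W = 0 ↔ ∀ a b x y, W a b x y = true → pi x y * p a b x y = 0 := by
  have hnn : ∀ z : A × B × X × Y, 0 ≤ pi z.2.2.1 z.2.2.2 *
      (if W z.1 z.2.1 z.2.2.1 z.2.2.2 then (1 : ℝ) else 0) * p z.1 z.2.1 z.2.2.1 z.2.2.2 :=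
    fun z => mul_nonneg (mul_nonneg (hpi _ _) (by positivity)) (hp.1 _ _ _ _)
  have hsum := Fintype.sum_eq_zero_iff_of_nonneg (Pi.le_def.2 hnn)
  simp only [Fintype.sum_prod_type, funext_iff, Prod.forall] at hsum
  rw [winProb, hsum]
  refine forall₄_congr fun a b x y => ?_
  cases W a b x y <;> simp

theorem winProb_le_one {p : A → B → X → Y → ℝ} (hp : IsCorrelation p) {pi : X → Y → ℝ}
    (hpi : ∀ x y, 0 ≤ pi x y) (hpi1 : ∑ x, ∑ y, pi x y = 1) (W : A → B → X → Y → Bool) :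
    winProb p pi W ≤ 1 := by
  linarith [winProb_add_winProb_not hp pi W, winProb_nonneg hp hpi fun a b x y => !W a b x y]

theorem winProb_eq_one_iff {p : A → B → X → Y → ℝ} (hp : IsCorrelation p) {pi : X → Y → ℝ}
    (hpi : ∀ x y, 0 ≤ pi x y) (hpi1 : ∑ x, ∑ y, pi x y = 1) (W : A → B → X → Y → Bool) :
    winProb p pi W = 1 ↔ ∀ a b x y, W a b x y = false → pi x y * p a b x y = 0 := by
  have hadd := winProb_add_winProb_not hp pi W
  have hzero := winProb_eq_zero_iff hp hpi fun a b x y => !W a b x y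
  simp only [Bool.not_eq_true'] at hzero
  rw [← hzero]
  constructor <;> intro h <;> linarith

theorem classicalValue_lt_one_iff [Nonempty A] [Nonempty B] {pi : X → Y → ℝ}
    (hpi : ∀ x y, 0 ≤ pi x y) (hpi1 : ∑ x, ∑ y, pi x y = 1) (W : A → B → X → Y → Bool) :
    classicalValue pi W < 1 ↔
      ∀ (f : X → A) (g : Y → B), ∃ x y, pi x y ≠ 0 ∧ W (f x) (g y) x y = false := by
  have hdet : ∀ (f : X → A) (g : Y → B), winProb (detLocal f g) pi W = 1 ↔
      ∀ x y, W (f x) (g y) x y = false → pi x y = 0 := by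
    intro f g
    rw [winProb_eq_one_iff (isNSCorrelation_detLocal f g).1 hpi hpi1]
    refine ⟨fun h x y hW => ?_, fun h a b x y hW => ?_⟩
    · simpa [detLocal_apply_self] using h _ _ x y hW
    · rcases detLocal_eq_zero_or (f := f) (g := g) a b x y with h0 | ⟨rfl, rfl⟩
      · rw [h0, mul_zero]
      · rw [h x y hW, zero_mul]
  have hle : ∀ fg : (X → A) × (Y → B), winProb (detLocal fg.1 fg.2) pi W ≤ 1 :=
    fun fg => winProb_le_one (isNSCorrelation_detLocal fg.1 fg.2).1 hpi hpi1 W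
  constructor
  · intro hlt f g
    by_contra! hne
    have h1 := (hdet f g).2 fun x y hW => by
      by_contra h0
      exact hne x y h0 hW
    have := le_ciSup (f := fun fg : (X → A) × (Y → B) => winProb (detLocal fg.1 fg.2) pi W)
      (Set.finite_range _).bddAbove (f, g)
    exact hlt.not_ge (h1.ge.trans this)
  · intro h
    obtain ⟨fg, hfg⟩ := exists_eq_ciSup_of_finite
      (f := fun fg : (X → A) × (Y → B) => winProb (detLocal fg.1 fg.2) pi W)
    rw [classicalValue, ← hfg]
    refine (hle fg).lt_of_ne fun h1 => ?_
    obtain ⟨x, y, h0, hW⟩ := h fg.1 fg.2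
    exact h0 ((hdet fg.1 fg.2).1 h1 x y hW)

theorem exists_pseudotelepathy_iff [Nonempty A] [Nonempty B] [Nonempty X] [Nonempty Y]
    {p : A → B → X → Y → ℝ} (hp : IsCorrelation p) :
    (∃ (pi : X → Y → ℝ) (W : A → B → X → Y → Bool),
      (∀ x y, 0 ≤ pi x y) ∧ (∑ x, ∑ y, pi x y = 1) ∧
        classicalValue pi W < 1 ∧ winProb p pi W = 1) ↔
      ∀ (f : X → A) (g : Y → B), ∃ x y, p (f x) (g y) x y = 0 := by
  constructor
  · rintro ⟨pi, W, hpi, hpi1, hC, hw⟩ f g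
    obtain ⟨x, y, h0, hW⟩ := (classicalValue_lt_one_iff hpi hpi1 W).1 hC f g
    exact ⟨x, y, (mul_eq_zero.1 ((winProb_eq_one_iff hp hpi hpi1 W).1 hw _ _ x y hW)).resolve_left
      h0⟩
  · intro h
    have hpi : ∀ (_ : X) (_ : Y), (0 : ℝ) ≤ (Fintype.card X * Fintype.card Y : ℝ)⁻¹ :=
      fun _ _ => by positivity
    have hne : (Fintype.card X * Fintype.card Y : ℝ) ≠ 0 := by simp
    have hpi1 : ∑ _ : X, ∑ _ : Y, (Fintype.card X * Fintype.card Y : ℝ)⁻¹ = 1 := by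
      simp only [sum_const, card_univ, nsmul_eq_mul, ← mul_assoc]
      exact mul_inv_cancel₀ hne
    refine ⟨_, fun a b x y => decide (p a b x y ≠ 0), hpi, hpi1,
      (classicalValue_lt_one_iff hpi hpi1 _).2 fun f g => ?_,
      (winProb_eq_one_iff hp hpi hpi1 _).2 fun a b x y hW => ?_⟩
    · obtain ⟨x, y, h0⟩ := h f g
      exact ⟨x, y, inv_ne_zero hne, by simp [h0]⟩
    · simp_all

/-- **Theorem 1 (FNS = FN = AVN = PT).** For a no-signaling correlation `p`, the following
are equivalent: (i) `p` lies in a face of the no-signaling set containing no local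
correlation; (ii) the local content of `p` is `0`; (iii) `p` realizes a table of zeros
that is not LHV-realizable; (iv) `p` is a perfect (pseudotelepathy) strategy for some
nonlocal game whose classical value is `< 1`. -/
theorem fns_fn_avn_pt_equivalence [Nonempty A] [Nonempty B] [Nonempty X] [Nonempty Y]
    (p : A → B → X → Y → ℝ) (hp : IsNSCorrelation p) :
    List.TFAE
      [ ∃ F : Set (A → B → X → Y → ℝ), IsFace F ∧ p ∈ F ∧ ∀ q ∈ F, ¬ IsLocal q,
        localContent p = 0,
        ∃ Z : Set (A × B × X × Y), Realizes p Z ∧ ¬ LHVRealizable Z,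
        ∃ (pi : X → Y → ℝ) (W : A → B → X → Y → Bool),
          (∀ x y, 0 ≤ pi x y) ∧ (∑ x, ∑ y, pi x y = 1) ∧
          classicalValue pi W < 1 ∧ winProb p pi W = 1 ] := by
  tfae_have 1 ↔ 3 := (exists_face_iff hp).trans exists_not_lhvRealizable_iff.symm
  tfae_have 2 ↔ 3 := (localContent_eq_zero_iff hp).trans exists_not_lhvRealizable_iff.symm
  tfae_have 4 ↔ 3 := (exists_pseudotelepathy_iff hp.1).trans exists_not_lhvRealizable_iff.symm
  tfae_finish
end

section
/- (Dual Bell-expression witness for full nonlocality.) Let p be a no-signaling correlation with local content q_L^max(p) = 0. Then there exists a function I : A × B × X × Y → ℝ with I(a,b,x,y) ≥ 0 for all a,b,x,y, with ∑_{a,b,x,y} I(a,b,x,y)·p(a,b|x,y) = 0 (equivalently, I(a,b,x,y) = 0 whenever p(a,b|x,y) > 0), and such that for every pair of functions f : X → A and g : Y → B one has ∑_{x∈X, y∈Y} I(f(x), g(y), x, y) ≥ 1. -/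
open Finset

variable {A B X Y : Type*} [Fintype A] [Fintype B] [Fintype X] [Fintype Y]
  [DecidableEq A] [DecidableEq B] [DecidableEq X] [DecidableEq Y]

omit [Fintype A] [Fintype X] [Fintype Y] [DecidableEq X] [DecidableEq Y] in
theorem sum_detLocal_right (f : X → A) (g : Y → B) (a : A) (x : X) (y : Y) :
    ∑ b, detLocal f g a b x y = if a = f x then 1 else 0 := by
  simp [detLocal]

omit [Fintype B] [Fintype X] [Fintype Y] [DecidableEq X] [DecidableEq Y] in
theorem sum_detLocal_left (f : X → A) (g : Y → B) (b : B) (x : X) (y : Y) :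
    ∑ a, detLocal f g a b x y = if b = g y then 1 else 0 := by
  simp [detLocal]

omit [Fintype X] [Fintype Y] [DecidableEq X] [DecidableEq Y] in
/-- Removing a weight `q < 1` of a deterministic local correlation from a no-signaling
correlation leaves, after renormalization, a no-signaling correlation, as long as `q` is
at most every probability on the graph of the deterministic strategy. -/
theorem IsNSCorrelation.sub_detLocal {p : A → B → X → Y → ℝ} (hp : IsNSCorrelation p)
    (f : X → A) (g : Y → B) {q : ℝ} (hq1 : q < 1) (hq : ∀ x y, q ≤ p (f x) (g y) x y) :
    IsNSCorrelation fun a b x y => (p a b x y - q * detLocal f g a b x y) / (1 - q) := by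
  obtain ⟨⟨hnonneg, hsum⟩, hA, hB⟩ := hp
  have h1q : 0 < 1 - q := sub_pos.2 hq1
  refine ⟨⟨fun a b x y => div_nonneg ?_ h1q.le, fun x y => ?_⟩,
    fun a x y y' => ?_, fun b y x x' => ?_⟩
  · by_cases ha : a = f x
    · by_cases hb : b = g y
      · subst ha hb
        simpa [detLocal] using hq x y
      · simpa [detLocal, hb] using hnonneg a b x y
    · simpa [detLocal, ha] using hnonneg a b x y
  · simp only [← Finset.sum_div, Finset.sum_sub_distrib, ← Finset.mul_sum,
      sum_detLocal_right, hsum]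
    simp [h1q.ne']
  · simp only [← Finset.sum_div, Finset.sum_sub_distrib, ← Finset.mul_sum,
      sum_detLocal_right, hA a x y y']
  · simp only [← Finset.sum_div, Finset.sum_sub_distrib, ← Finset.mul_sum,
      sum_detLocal_left, hB b y x x']

theorem le_localContent {p pL pNL : A → B → X → Y → ℝ} {q : ℝ} (hq0 : 0 ≤ q) (hq1 : q ≤ 1)
    (hL : IsLocal pL) (hNL : IsNSCorrelation pNL)
    (h : ∀ a b x y, p a b x y = q * pL a b x y + (1 - q) * pNL a b x y) :
    q ≤ localContent p :=
  le_csSup ⟨1, fun _ hr => hr.2.1⟩ ⟨hq0, hq1, pL, pNL, hL, hNL, h⟩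

/-- A deterministic strategy inside the support of `p` gives `p` a positive local content. -/
theorem localContent_pos [Nonempty X] [Nonempty Y] {p : A → B → X → Y → ℝ}
    (hp : IsNSCorrelation p) (f : X → A) (g : Y → B) (hpos : ∀ x y, 0 < p (f x) (g y) x y) :
    0 < localContent p := by
  obtain ⟨z, hz⟩ := Finite.exists_min fun z : X × Y => p (f z.1) (g z.2) z.1 z.2
  have hq0 : 0 < min (1 / 2) (p (f z.1) (g z.2) z.1 z.2) := lt_min (by norm_num) (hpos _ _)
  have hq1 : min (1 / 2) (p (f z.1) (g z.2) z.1 z.2) < 1 :=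
    (min_le_left _ _).trans_lt (by norm_num)
  refine hq0.trans_le (le_localContent hq0.le hq1.le (isLocal_detLocal f g)
    (hp.sub_detLocal f g hq1 fun x y => (min_le_right _ _).trans (hz (x, y)))
    fun a b x y => ?_)
  rw [mul_div_cancel₀ _ (sub_pos.2 hq1).ne']
  ring

/-- **Dual Bell-expression witness for full nonlocality.** If a no-signaling correlation
`p` has local content `0`, then there is a nonnegative Bell expression `I` vanishing on
the support of `p` whose value on every deterministic local strategy is at least `1`. -/
theorem dual_witness_of_full_nonlocality [Nonempty A] [Nonempty B] [Nonempty X] [Nonempty Y]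
    (p : A → B → X → Y → ℝ) (hp : IsNSCorrelation p) (h0 : localContent p = 0) :
    ∃ I : A → B → X → Y → ℝ,
      (∀ a b x y, 0 ≤ I a b x y) ∧
      (∑ a, ∑ b, ∑ x, ∑ y, I a b x y * p a b x y = 0) ∧
      (∀ a b x y, 0 < p a b x y → I a b x y = 0) ∧
      (∀ (f : X → A) (g : Y → B), 1 ≤ ∑ x, ∑ y, I (f x) (g y) x y) := by
  refine ⟨fun a b x y => if p a b x y = 0 then 1 else 0, fun a b x y => ?_, ?_,
    fun a b x y h => if_neg h.ne', fun f g => ?_⟩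
  · dsimp only
    split_ifs <;> norm_num
  · simp +contextual [ite_mul]
  · obtain ⟨x, y, hxy⟩ : ∃ x y, p (f x) (g y) x y = 0 := by
      by_contra! h
      exact (localContent_pos hp f g fun x y =>
        (hp.1.1 (f x) (g y) x y).lt_of_ne' (h x y)).ne' h0
    have hnonneg (x : X) (y : Y) : (0 : ℝ) ≤ if p (f x) (g y) x y = 0 then 1 else 0 := by
      split_ifs <;> norm_num
    calc (1 : ℝ) = if p (f x) (g y) x y = 0 then 1 else 0 := (if_pos hxy).symm
      _ ≤ ∑ y, if p (f x) (g y) x y = 0 then 1 else 0 :=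
        Finset.single_le_sum (fun y _ => hnonneg x y) (Finset.mem_univ y)
      _ ≤ ∑ x, ∑ y, if p (f x) (g y) x y = 0 then 1 else 0 :=
        Finset.single_le_sum (f := fun x => ∑ y, if p (f x) (g y) x y = 0 then (1 : ℝ) else 0)
          (fun x _ => Finset.sum_nonneg fun y _ => hnonneg x y) (Finset.mem_univ x)
end

section
/- (AVN implies pseudotelepathy.) Let Z ⊆ A × B × X × Y be a table of zeros that is not LHV-realizable, and let p be a no-signaling correlation realizing Z. Define the nonlocal game (π, W) by π(x,y) = 1/(|X|·|Y|) for all x,y, and W(a,b,x,y) = 0 if (a,b,x,y) ∈ Z and W(a,b,x,y) = 1 otherwise. Then the winning probability of p is ω^p(π,W) = 1, while the classical value satisfies ω_C(π,W) < 1. -/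
open Finset

variable {A B X Y : Type*} [Fintype A] [Fintype B] [Fintype X] [Fintype Y]
  [DecidableEq A] [DecidableEq B] [DecidableEq X] [DecidableEq Y]

set_option linter.unusedSectionVars false

/-- The winning probability, with the sum over settings taken outermost. -/
theorem winProb_eq_sum_settings (p : A → B → X → Y → ℝ) (pi : X → Y → ℝ)
    (W : A → B → X → Y → Bool) :
    winProb p pi W =
      ∑ x, ∑ y, pi x y * ∑ a, ∑ b, (if W a b x y then (1:ℝ) else 0) * p a b x y := by
  simp only [winProb, mul_sum, ← mul_assoc]
  simp_rw [sum_comm (s := (univ : Finset B)) (t := (univ : Finset X)),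
    sum_comm (s := (univ : Finset B)) (t := (univ : Finset Y))]
  rw [sum_comm]
  exact sum_congr rfl fun x _ => sum_comm

/-- A deterministic strategy wins on exactly the settings where its answers are accepted. -/
theorem winProb_detLocal (f : X → A) (g : Y → B) (pi : X → Y → ℝ)
    (W : A → B → X → Y → Bool) :
    winProb (detLocal f g) pi W =
      ∑ x, ∑ y, pi x y * (if W (f x) (g y) x y then (1:ℝ) else 0) := by
  rw [winProb_eq_sum_settings]
  simp [detLocal]

/-- A correlation whose support is accepted by `W` wins with probability one. -/
theorem winProb_eq_one {p : A → B → X → Y → ℝ} (hp : IsCorrelation p) {pi : X → Y → ℝ}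
    (hpi : ∑ x, ∑ y, pi x y = 1) {W : A → B → X → Y → Bool}
    (hW : ∀ a b x y, W a b x y = false → p a b x y = 0) : winProb p pi W = 1 := by
  rw [winProb_eq_sum_settings]
  refine Eq.trans ?_ hpi
  refine sum_congr rfl fun x _ => sum_congr rfl fun y _ => ?_
  have h : ∀ a b, (if W a b x y then (1:ℝ) else 0) * p a b x y = p a b x y := by
    intro a b
    cases hab : W a b x y
    · simp [hW a b x y hab]
    · simp
  simp only [h, hp.2 x y, mul_one]

/-- A deterministic strategy that loses on some pair of settings asked with positive
probability wins with probability less than one. -/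
theorem winProb_detLocal_lt_one {f : X → A} {g : Y → B} {pi : X → Y → ℝ}
    (hpos : ∀ x y, 0 < pi x y) (hpi : ∑ x, ∑ y, pi x y = 1) {W : A → B → X → Y → Bool}
    (hW : ∃ x y, W (f x) (g y) x y = false) : winProb (detLocal f g) pi W < 1 := by
  obtain ⟨x₀, y₀, h₀⟩ := hW
  have hle : ∀ x y, pi x y * (if W (f x) (g y) x y then (1:ℝ) else 0) ≤ pi x y := by
    intro x y
    split_ifs <;> simp [(hpos x y).le]
  rw [winProb_detLocal]
  refine lt_of_lt_of_eq ?_ hpi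
  refine sum_lt_sum (fun x _ => sum_le_sum fun y _ => hle x y) ⟨x₀, mem_univ _, ?_⟩
  refine sum_lt_sum (fun y _ => hle x₀ y) ⟨y₀, mem_univ _, ?_⟩
  simpa [h₀] using hpos x₀ y₀

/-- The classical value is below one if every deterministic strategy wins with
probability less than one. -/
theorem classicalValue_lt_one [Nonempty A] [Nonempty B] {pi : X → Y → ℝ}
    {W : A → B → X → Y → Bool} (h : ∀ f g, winProb (detLocal f g) pi W < 1) :
    classicalValue pi W < 1 := by
  obtain ⟨fg, hfg⟩ := exists_eq_ciSup_of_finite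
    (f := fun fg : (X → A) × (Y → B) => winProb (detLocal fg.1 fg.2) pi W)
  rw [classicalValue, ← hfg]
  exact h fg.1 fg.2

/-- **AVN implies pseudotelepathy.** If `p` is a no-signaling correlation realizing a
table of zeros `Z` that is not LHV-realizable, then the game with uniform inputs whose
winning condition forbids exactly the entries of `Z` is won by `p` with probability `1`,
while its classical value is `< 1`. -/
theorem avn_implies_pt [Nonempty A] [Nonempty B] [Nonempty X] [Nonempty Y]
    (Z : Set (A × B × X × Y)) (hZ : ¬ LHVRealizable Z)
    (p : A → B → X → Y → ℝ) (hp : IsNSCorrelation p) (hreal : Realizes p Z)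
    (pi : X → Y → ℝ)
    (hpi : ∀ x y, pi x y = 1 / ((Fintype.card X : ℝ) * (Fintype.card Y : ℝ)))
    (W : A → B → X → Y → Bool)
    (hW : ∀ a b x y, W a b x y = true ↔ (a, b, x, y) ∉ Z) :
    winProb p pi W = 1 ∧ classicalValue pi W < 1 := by
  have hX : (0:ℝ) < Fintype.card X := by exact_mod_cast Fintype.card_pos
  have hY : (0:ℝ) < Fintype.card Y := by exact_mod_cast Fintype.card_pos
  have hpos : ∀ x y, 0 < pi x y := fun x y => by rw [hpi]; positivity
  have hsum : ∑ x, ∑ y, pi x y = 1 := by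
    simp only [hpi, sum_const, card_univ, nsmul_eq_mul]
    field_simp
  have hmem : ∀ a b x y, W a b x y = false ↔ (a, b, x, y) ∈ Z := fun a b x y => by
    rw [← Bool.not_eq_true, hW, not_not]
  refine ⟨winProb_eq_one hp.1 hsum fun a b x y h => hreal a b x y ((hmem a b x y).1 h),
    classicalValue_lt_one fun f g => winProb_detLocal_lt_one hpos hsum ?_⟩
  by_contra! hne
  exact hZ ⟨f, g, fun x y hz => hne x y ((hmem _ _ x y).2 hz)⟩
end

section
/- (The magic-square table of zeros admits no local hidden-variable model.) For every pair of functions f : Fin 3 → A₀ and g : Fin 3 → B₀, there exist x, y ∈ Fin 3 such that (f x) y ≠ (g y) x. -/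
/-- Alice's outputs in the magic square game: even-parity bit triples. -/
abbrev MSA : Type := {v : Fin 3 → ZMod 2 // v 0 + v 1 + v 2 = 0}

/-- Bob's outputs in the magic square game: odd-parity bit triples. -/
abbrev MSB : Type := {w : Fin 3 → ZMod 2 // w 0 + w 1 + w 2 = 1}

/-- **The magic-square table of zeros admits no local hidden-variable model.** For every
deterministic strategy `(f, g)` there is a pair of inputs `(x, y)` on which the
intersection entries disagree. -/
theorem magic_square_no_lhv (f : Fin 3 → MSA) (g : Fin 3 → MSB) :
    ∃ x y : Fin 3, (f x).val y ≠ (g y).val x := by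
  by_contra! h
  have hrows : ∑ x, ∑ y, (f x).val y = 0 :=
    Finset.sum_eq_zero fun x _ => (Fin.sum_univ_three _).trans (f x).property
  have hcols : ∑ y, ∑ x, (g y).val x = 1 := by
    simp_rw [Fin.sum_univ_three, (g _).property]
    decide
  rw [Finset.sum_comm] at hrows
  simp_rw [h] at hrows
  exact zero_ne_one (hrows.symm.trans hcols)
end

section
/- (Criticality of the magic-square table of zeros.) For every (x₀, y₀) ∈ Fin 3 × Fin 3 there exist functions f : Fin 3 → A₀ and g : Fin 3 → B₀ such that (f x) y = (g y) x for all (x, y) ∈ Fin 3 × Fin 3 with (x, y) ≠ (x₀, y₀). That is, if any single block of the magic-square table of zeros is removed, the remaining table is realizable by a local deterministic assignment. -/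
/-- **Criticality of the magic-square table of zeros.** If any single block `(x₀, y₀)` of
the table is removed, the remaining table is realizable by a local deterministic
assignment. -/
theorem magic_square_critical (x₀ y₀ : Fin 3) :
    ∃ (f : Fin 3 → MSA) (g : Fin 3 → MSB),
      ∀ x y : Fin 3, (x, y) ≠ (x₀, y₀) → (f x).val y = (g y).val x := by
  refine ⟨fun x => ⟨fun y => if x = x₀ ∧ y ≠ y₀ then 1 else 0, ?_⟩,
    fun _ => ⟨Pi.single x₀ 1, ?_⟩, fun x y h => ?_⟩
  · by_cases hx : x = x₀
    · simp only [hx, true_and]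
      revert y₀
      decide
    · simp [hx]
  · revert x₀
    decide
  · by_cases hx : x = x₀
    · have hy : y ≠ y₀ := fun hy => h (by rw [hx, hy])
      simp [hx, hy]
    · simp [hx]
end

section
/- (Classical value of the magic square game is 8/9.) The maximum over all pairs of functions f : Fin 3 → A₀ and g : Fin 3 → B₀ of the number of pairs (x, y) ∈ Fin 3 × Fin 3 with (f x) y = (g y) x equals 8. Equivalently, with the uniform input distribution, the classical winning probability of the magic square game is 8/9. -/
/-- No pair of strategies wins on every input: the sum of all entries would be both even and odd. -/
theorem MSA.exists_ne (f : Fin 3 → MSA) (g : Fin 3 → MSB) :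
    ∃ x y, (f x).val y ≠ (g y).val x := by
  by_contra! h
  have rows : ∑ x, ∑ y, (f x).val y = 0 :=
    Finset.sum_eq_zero fun x _ => by rw [Fin.sum_univ_three]; exact (f x).property
  have columns : ∑ y, ∑ x, (g y).val x = 1 := by
    have column (y : Fin 3) : ∑ x, (g y).val x = 1 := by
      rw [Fin.sum_univ_three]; exact (g y).property
    simp only [column]
    decide
  rw [Finset.sum_comm] at rows
  simp only [h, columns] at rows
  exact one_ne_zero rows

/-- **Classical value of the magic square game is 8/9.** The maximum over deterministic
strategies `(f, g)` of the number of input pairs `(x, y)` with `(f x) y = (g y) x`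
equals `8` (out of the 9 input pairs). -/
theorem magic_square_classical_value :
    IsGreatest {k : ℕ | ∃ (f : Fin 3 → MSA) (g : Fin 3 → MSB),
      k = (Finset.univ.filter fun xy : Fin 3 × Fin 3 =>
            (f xy.1).val xy.2 = (g xy.2).val xy.1).card} 8 := by
  constructor
  · refine ⟨![⟨![1, 1, 0], by decide⟩, ⟨0, by decide⟩, ⟨0, by decide⟩],
      fun _ => ⟨![1, 0, 0], by decide⟩, ?_⟩
    decide
  · rintro k ⟨f, g, rfl⟩
    obtain ⟨x, y, hxy⟩ := MSA.exists_ne f g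
    have lt_nine := Finset.card_lt_card
      (Finset.filter_ssubset (p := fun xy : Fin 3 × Fin 3 =>
        (f xy.1).val xy.2 = (g xy.2).val xy.1).mpr ⟨(x, y), Finset.mem_univ _, hxy⟩)
    rw [Finset.card_univ, Fintype.card_prod, Fintype.card_fin] at lt_nine
    exact Nat.le_of_lt_succ lt_nine
end

section
/- (A critical nonlocal table of zeros in the (3,2;3,3) Bell scenario.) Let Z ⊆ Fin 2 × Fin 3 × Fin 3 × Fin 3 (entries (a, b, x, y) with a ∈ Fin 2, b ∈ Fin 3, x ∈ Fin 3, y ∈ Fin 3) be the set Z = {(0,0,0,0), (0,1,0,0), (1,2,0,1), (1,0,0,2), (0,2,1,0), (1,2,1,1), (1,0,1,2), (0,1,2,2), (0,2,2,2), (1,0,2,1), (1,1,2,1)}. Then Z is not LHV-realizable: for every pair of functions f : Fin 3 → Fin 2 and g : Fin 3 → Fin 3, there exist x, y ∈ Fin 3 with (f x, g y, x, y) ∈ Z. -/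
/-- A critical nonlocal table of zeros in the `(3,2;3,3)` Bell scenario: entries are
events `(a, b, x, y)` with Alice's outcome `a : Fin 2`, Bob's outcome `b : Fin 3`,
and settings `x y : Fin 3`. -/
def cntzTable : Set (Fin 2 × Fin 3 × Fin 3 × Fin 3) :=
  {(0,0,0,0), (0,1,0,0), (1,2,0,1), (1,0,0,2), (0,2,1,0), (1,2,1,1), (1,0,1,2),
   (0,1,2,2), (0,2,2,2), (1,0,2,1), (1,1,2,1)}

/-- **The table `cntzTable` is not LHV-realizable:** every pair of deterministic outcome
assignments `f`, `g` hits one of its zeros. -/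
theorem cntz_not_lhv_realizable (f : Fin 3 → Fin 2) (g : Fin 3 → Fin 3) :
    ∃ x y : Fin 3, (f x, g y, x, y) ∈ cntzTable := by
  by_contra! h
  have h00 := h 0 0
  have h10 := h 1 0
  have h01 := h 0 1
  have h11 := h 1 1
  have h02 := h 0 2
  have h12 := h 1 2
  have h21 := h 2 1
  have h22 := h 2 2
  simp [cntzTable] at h00 h10 h01 h11 h02 h12 h21 h22
  -- Bob's answer to `0` forces Alice to answer `1` to `0` or `1`; Bob's answers to `1` and `2`
  -- are then restricted in the same way, and no answer to `2` is left for Alice.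
  omega
end

section
/- (Lifting preserves pseudotelepathy and gives classical value (n−1+ω_C)/n.) Let (π, W) be a nonlocal game on the scenario (X, A; Y, B) with uniform input distribution π(x,y) = 1/(|X|·|Y|), and let n ≥ 1. Define the lifted game (π̃, W̃) on the scenario with input sets X × Fin n and Y × Fin n and the same output sets, where π̃ is uniform and W̃(a, b, (x,i), (y,j)) = W(a,b,x,y) if i = j, and W̃(a, b, (x,i), (y,j)) = 1 if i ≠ j. Then: (1) the classical value satisfies ω_C(π̃, W̃) = (n − 1 + ω_C(π, W))/n, so in particular ω_C(π̃, W̃) < 1 if and only if ω_C(π, W) < 1; and (2) if there exists a no-signaling correlation p on (X, A; Y, B) with ω^p(π,W) = 1, then there exists a no-signaling correlation p̃ on the lifted scenario with ω^{p̃}(π̃, W̃) = 1 (e.g., p̃(a,b|(x,i),(y,j)) = p(a,b|x,y) for i = j and p̃(a,b|(x,i),(y,j)) = (∑_{b'} p(a,b'|x,y))·(∑_{a'} p(a',b|x,y)) for i ≠ j). -/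
open Finset

variable {A B X Y : Type*} [Fintype A] [Fintype B] [Fintype X] [Fintype Y]
  [DecidableEq A] [DecidableEq B] [DecidableEq X] [DecidableEq Y]

/-- The total weight that `p` puts on winning outcomes at the settings `x`, `y`. -/
def winAt (p : A → B → X → Y → ℝ) (W : A → B → X → Y → Bool) (x : X) (y : Y) : ℝ :=
  ∑ a, ∑ b, (if W a b x y then (1:ℝ) else 0) * p a b x y

omit [DecidableEq A] [DecidableEq B] [DecidableEq X] [DecidableEq Y] in
theorem winProb_eq_sum_winAt (p : A → B → X → Y → ℝ) (pi : X → Y → ℝ)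
    (W : A → B → X → Y → Bool) :
    winProb p pi W = ∑ x, ∑ y, pi x y * winAt p W x y := by
  unfold winProb winAt
  simp only [Finset.mul_sum, ← Fintype.sum_prod_type']
  exact Fintype.sum_equiv
    ⟨fun z => (z.2.2.1, z.2.2.2, z.1, z.2.1), fun z => (z.2.2.1, z.2.2.2, z.1, z.2.1),
      fun _ => rfl, fun _ => rfl⟩ _ _ fun _ => mul_assoc _ _ _

omit [Fintype X] [Fintype Y] [DecidableEq X] [DecidableEq Y] in
theorem isCorrelation_detLocal (f : X → A) (g : Y → B) : IsCorrelation (detLocal f g) := by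
  refine ⟨fun a b x y => ?_, fun x y => ?_⟩
  · unfold detLocal
    positivity
  · simp [detLocal]

omit [DecidableEq A] [DecidableEq B] [DecidableEq X] [DecidableEq Y] in
/-- The winning probability in the lifted game, in terms of those of the diagonal slices. -/
theorem winProb_lift [Nonempty X] [Nonempty Y] (n : ℕ) (hn : 1 ≤ n)
    (pi : X → Y → ℝ) (W : A → B → X → Y → Bool)
    (hpi : ∀ x y, pi x y = 1 / ((Fintype.card X : ℝ) * (Fintype.card Y : ℝ)))
    (pit : X × Fin n → Y × Fin n → ℝ)
    (hpit : ∀ xi yj, pit xi yj =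
      1 / (((Fintype.card X : ℝ) * n) * ((Fintype.card Y : ℝ) * n)))
    (Wt : A → B → X × Fin n → Y × Fin n → Bool)
    (hWt : ∀ a b xi yj, Wt a b xi yj = if xi.2 = yj.2 then W a b xi.1 yj.1 else true)
    (q : A → B → X × Fin n → Y × Fin n → ℝ) (hq : IsCorrelation q) :
    winProb q pit Wt =
      ((n : ℝ) - 1 + (∑ i, winProb (fun a b x y => q a b (x, i) (y, i)) pi W) / n) / n := by
  have hwin : ∀ x i y j, winAt q Wt (x, i) (y, j) =
      1 + if i = j then winAt (fun a b x y => q a b (x, i) (y, i)) W x y - 1 else 0 := by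
    intro x i y j
    by_cases h : i = j
    · subst h
      simp [winAt, hWt]
    · simpa [winAt, hWt, h] using hq.2 (x, i) (y, j)
  have hsum : ∑ x, ∑ i, ∑ y, ∑ j, winAt q Wt (x, i) (y, j) =
      Fintype.card X * Fintype.card Y * ((n : ℝ) * n - n) +
        ∑ i, ∑ x, ∑ y, winAt (fun a b x y => q a b (x, i) (y, i)) W x y := by
    simp only [hwin, Finset.sum_add_distrib, Finset.sum_ite_eq, Finset.mem_univ, if_true,
      Finset.sum_sub_distrib, Finset.sum_const, Finset.card_univ, Fintype.card_fin, nsmul_eq_mul]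
    rw [Finset.sum_comm]
    ring
  have hX : (Fintype.card X : ℝ) ≠ 0 := by simp
  have hY : (Fintype.card Y : ℝ) ≠ 0 := by simp
  have hn0 : (n : ℝ) ≠ 0 := by positivity
  simp only [winProb_eq_sum_winAt, hpi, hpit, ← Finset.mul_sum, Fintype.sum_prod_type, hsum]
  field_simp

omit [DecidableEq X] [DecidableEq Y] in
theorem winProb_detLocal_le_classicalValue (pi : X → Y → ℝ) (W : A → B → X → Y → Bool)
    (f : X → A) (g : Y → B) : winProb (detLocal f g) pi W ≤ classicalValue pi W :=
  le_ciSup (f := fun fg : (X → A) × (Y → B) => winProb (detLocal fg.1 fg.2) pi W)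
    (Set.finite_range _).bddAbove (f, g)

omit [DecidableEq X] [DecidableEq Y] in
theorem exists_winProb_detLocal_eq_classicalValue [Nonempty A] [Nonempty B] (pi : X → Y → ℝ)
    (W : A → B → X → Y → Bool) :
    ∃ (f : X → A) (g : Y → B), winProb (detLocal f g) pi W = classicalValue pi W := by
  obtain ⟨fg, h⟩ := exists_eq_ciSup_of_finite
    (f := fun fg : (X → A) × (Y → B) => winProb (detLocal fg.1 fg.2) pi W)
  exact ⟨fg.1, fg.2, h⟩

/-- The lift of a correlation: `p` on equal copy indices, and the product of the marginals of `p`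
on different ones. -/
def liftCorrelation (n : ℕ) (p : A → B → X → Y → ℝ) : A → B → X × Fin n → Y × Fin n → ℝ :=
  fun a b xi yj => if xi.2 = yj.2 then p a b xi.1 yj.1 else
    (∑ b', p a b' xi.1 yj.1) * ∑ a', p a' b xi.1 yj.1

omit [Fintype X] [Fintype Y] [DecidableEq A] [DecidableEq B]
  [DecidableEq X] [DecidableEq Y] in
theorem sum_right_liftCorrelation (n : ℕ) {p : A → B → X → Y → ℝ} (hp : IsCorrelation p)
    (a : A) (xi : X × Fin n) (yj : Y × Fin n) :
    ∑ b, liftCorrelation n p a b xi yj = ∑ b, p a b xi.1 yj.1 := by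
  by_cases h : xi.2 = yj.2
  · simp [liftCorrelation, h]
  · simp only [liftCorrelation, h, if_false]
    rw [← Finset.mul_sum, Finset.sum_comm, hp.2, mul_one]

omit [Fintype X] [Fintype Y] [DecidableEq A] [DecidableEq B]
  [DecidableEq X] [DecidableEq Y] in
theorem sum_left_liftCorrelation (n : ℕ) {p : A → B → X → Y → ℝ} (hp : IsCorrelation p)
    (b : B) (xi : X × Fin n) (yj : Y × Fin n) :
    ∑ a, liftCorrelation n p a b xi yj = ∑ a, p a b xi.1 yj.1 := by
  by_cases h : xi.2 = yj.2
  · simp [liftCorrelation, h]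
  · simp only [liftCorrelation, h, if_false]
    rw [← Finset.sum_mul, hp.2, one_mul]

omit [Fintype X] [Fintype Y] [DecidableEq A] [DecidableEq B]
  [DecidableEq X] [DecidableEq Y] in
theorem isNSCorrelation_liftCorrelation (n : ℕ) {p : A → B → X → Y → ℝ}
    (hp : IsNSCorrelation p) : IsNSCorrelation (liftCorrelation n p) := by
  obtain ⟨hc, hA, hB⟩ := hp
  refine ⟨⟨fun a b xi yj => ?_, fun xi yj => ?_⟩, fun a xi yj yj' => ?_, fun b yj xi xi' => ?_⟩
  · unfold liftCorrelation
    split_ifs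
    · exact hc.1 _ _ _ _
    · exact mul_nonneg (Finset.sum_nonneg fun _ _ => hc.1 _ _ _ _)
        (Finset.sum_nonneg fun _ _ => hc.1 _ _ _ _)
  · simp only [sum_right_liftCorrelation n hc, hc.2]
  · simp only [sum_right_liftCorrelation n hc]
    exact hA _ _ _ _
  · simp only [sum_left_liftCorrelation n hc]
    exact hB _ _ _ _

/-- **Lifting preserves pseudotelepathy and gives classical value `(n − 1 + ω_C)/n`.**
For a game `(π, W)` with uniform inputs, the lifted game on settings `X × Fin n`,
`Y × Fin n` (which plays `W` when the copy indices agree and is won for free otherwise)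
has classical value `(n − 1 + ω_C(π,W))/n`; in particular its classical value is `< 1`
iff `ω_C(π,W) < 1`. Moreover, if some no-signaling correlation wins `(π, W)` perfectly,
then some no-signaling correlation wins the lifted game perfectly. -/
theorem lifting_preserves_pt [Nonempty A] [Nonempty B] [Nonempty X] [Nonempty Y]
    (n : ℕ) (hn : 1 ≤ n)
    (pi : X → Y → ℝ) (W : A → B → X → Y → Bool)
    (hpi : ∀ x y, pi x y = 1 / ((Fintype.card X : ℝ) * (Fintype.card Y : ℝ)))
    (pit : X × Fin n → Y × Fin n → ℝ)
    (hpit : ∀ xi yj, pit xi yj =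
      1 / (((Fintype.card X : ℝ) * n) * ((Fintype.card Y : ℝ) * n)))
    (Wt : A → B → X × Fin n → Y × Fin n → Bool)
    (hWt : ∀ a b xi yj, Wt a b xi yj = if xi.2 = yj.2 then W a b xi.1 yj.1 else true) :
    (classicalValue pit Wt = ((n : ℝ) - 1 + classicalValue pi W) / n ∧
      (classicalValue pit Wt < 1 ↔ classicalValue pi W < 1)) ∧
    ((∃ p : A → B → X → Y → ℝ, IsNSCorrelation p ∧ winProb p pi W = 1) →
      ∃ pt : A → B → X × Fin n → Y × Fin n → ℝ,
        IsNSCorrelation pt ∧ winProb pt pit Wt = 1) := by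
  have hn0 : (0 : ℝ) < n := by positivity
  have hlift := winProb_lift n hn pi W hpi pit hpit Wt hWt
  have hval : classicalValue pit Wt = ((n : ℝ) - 1 + classicalValue pi W) / n := by
    apply le_antisymm
    · obtain ⟨f, g, hfg⟩ := exists_winProb_detLocal_eq_classicalValue pit Wt
      rw [← hfg, hlift _ (isCorrelation_detLocal f g)]
      gcongr
      rw [div_le_iff₀ hn0]
      calc ∑ i, winProb (fun a b x y => detLocal f g a b (x, i) (y, i)) pi W
          ≤ ∑ _i : Fin n, classicalValue pi W :=
            Finset.sum_le_sum fun i _ => winProb_detLocal_le_classicalValue pi W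
              (fun x => f (x, i)) (fun y => g (y, i))
        _ = classicalValue pi W * n := by simp [mul_comm]
    · obtain ⟨f, g, hfg⟩ := exists_winProb_detLocal_eq_classicalValue pi W
      have hle := winProb_detLocal_le_classicalValue pit Wt
        (fun xi => f xi.1) (fun yj => g yj.1)
      rw [hlift _ (isCorrelation_detLocal _ _)] at hle
      change ((n : ℝ) - 1 + (∑ _i : Fin n, winProb (detLocal f g) pi W) / n) / n ≤ _ at hle
      simpa [hfg, hn0.ne'] using hle
  refine ⟨⟨hval, ?_⟩, ?_⟩
  · rw [hval, div_lt_one hn0]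
    constructor <;> intro h <;> linarith
  · rintro ⟨p, hp, hwin⟩
    have hpt := isNSCorrelation_liftCorrelation n hp
    refine ⟨liftCorrelation n p, hpt, ?_⟩
    have hslice : ∀ i : Fin n,
        (fun a b x y => liftCorrelation n p a b (x, i) (y, i)) = p := fun i => by
      simp [liftCorrelation]
    rw [hlift _ hpt.1]
    simp [hslice, hwin, hn0.ne']
end

section
/- (Nonlocal content of the maximal CHSH violation is √2 − 1.) Let p_CHSH be the correlation on the (2,2;2,2) Bell scenario (all of a, b, x, y in Fin 2) defined by p_CHSH(a,b|x,y) = (1/4)·(1 + (−1)^{a+b+x·y}/√2), where a+b+x·y is computed as an integer. Then p_CHSH is a no-signaling correlation, and its local content equals q_L^max(p_CHSH) = 2 − √2; equivalently, its nonlocal content is √2 − 1. -/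
open Finset

variable {A B X Y : Type*} [Fintype A] [Fintype B] [Fintype X] [Fintype Y]
  [DecidableEq A] [DecidableEq B] [DecidableEq X] [DecidableEq Y]

/-- The quantum correlation maximally violating the CHSH inequality in the `(2,2;2,2)`
Bell scenario: `p(a,b|x,y) = (1/4)·(1 + (−1)^(a+b+x·y)/√2)`. -/
noncomputable def pCHSH : Fin 2 → Fin 2 → Fin 2 → Fin 2 → ℝ :=
  fun a b x y => (1 / 4) * (1 + (-1 : ℝ) ^ (a.val + b.val + x.val * y.val) / Real.sqrt 2)

/-- The total probability, over the four settings, of violating `a + b ≡ x * y (mod 2)`. -/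
def chshLoss (p : Fin 2 → Fin 2 → Fin 2 → Fin 2 → ℝ) : ℝ :=
  p 0 1 0 0 + p 1 0 0 0 + p 0 1 0 1 + p 1 0 0 1 + p 0 1 1 0 + p 1 0 1 0 + p 0 0 1 1 + p 1 1 1 1

lemma one_le_chshLoss_detLocal (f g : Fin 2 → Fin 2) : 1 ≤ chshLoss (detLocal f g) := by
  have h : ∀ i : Fin 2, i = 0 ∨ i = 1 := by decide
  rcases h (f 0) with h0 | h0 <;> rcases h (f 1) with h1 | h1 <;>
    rcases h (g 0) with h2 | h2 <;> rcases h (g 1) with h3 | h3 <;>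
    simp [chshLoss, detLocal, h0, h1, h2, h3]

lemma IsLocal.one_le_chshLoss {p : Fin 2 → Fin 2 → Fin 2 → Fin 2 → ℝ} (hp : IsLocal p) :
    1 ≤ chshLoss p := by
  obtain ⟨μ, hμ, hsum, hdec⟩ := hp
  have hL : chshLoss p = ∑ fg, μ fg * chshLoss (detLocal fg.1 fg.2) := by
    simp only [chshLoss, hdec, mul_add, Finset.sum_add_distrib]
  rw [hL, ← hsum]
  exact Finset.sum_le_sum fun fg _ =>
    le_mul_of_one_le_right (hμ fg) (one_le_chshLoss_detLocal fg.1 fg.2)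

lemma chshLoss_pCHSH : chshLoss pCHSH = 2 - √2 := by
  have h : √2 * √2 = 2 := Real.mul_self_sqrt (by norm_num)
  have h0 : √2 ≠ 0 := by positivity
  simp [chshLoss, pCHSH]
  field_simp
  linarith

lemma isNSCorrelation_pCHSH : IsNSCorrelation pCHSH := by
  have h1 : 1 ≤ √2 := Real.one_le_sqrt.2 (by norm_num)
  have h2 : (√2)⁻¹ ≤ 1 := inv_le_one_of_one_le₀ h1
  have h3 : 0 ≤ (√2)⁻¹ := by positivity
  refine ⟨⟨fun a b x y => ?_, fun x y => ?_⟩, fun a x y y' => ?_, fun b y x x' => ?_⟩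
  · unfold pCHSH
    rcases neg_one_pow_eq_or ℝ (a.val + b.val + x.val * y.val) with h | h <;>
      rw [h, div_eq_mul_inv _ √2] <;> linarith
  · simp only [pCHSH, Fin.sum_univ_two, pow_add]
    simp
    ring
  · simp only [pCHSH, Fin.sum_univ_two, pow_add]
    simp
    ring
  · simp only [pCHSH, Fin.sum_univ_two, pow_add]
    simp
    ring

/-- The Popescu–Rohrlich box. -/
noncomputable def prBox : Fin 2 → Fin 2 → Fin 2 → Fin 2 → ℝ :=
  fun a b x y => (1 / 4) * (1 + (-1 : ℝ) ^ (a.val + b.val + x.val * y.val))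

lemma isNSCorrelation_prBox : IsNSCorrelation prBox := by
  refine ⟨⟨fun a b x y => ?_, fun x y => ?_⟩, fun a x y y' => ?_, fun b y x x' => ?_⟩
  · unfold prBox
    rcases neg_one_pow_eq_or ℝ (a.val + b.val + x.val * y.val) with h | h <;>
      rw [h] <;> norm_num
  · simp only [prBox, Fin.sum_univ_two, pow_add]
    simp
    ring
  · simp only [prBox, Fin.sum_univ_two, pow_add]
    simp
    ring
  · simp only [prBox, Fin.sum_univ_two, pow_add]
    simp
    ring

/-- The mixture of the deterministic strategies that win the CHSH game on three settings. -/
noncomputable def chshLocalPart : Fin 2 → Fin 2 → Fin 2 → Fin 2 → ℝ :=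
  fun a b x y => (1 / 4) * (1 + (-1 : ℝ) ^ (a.val + b.val + x.val * y.val) / 2)

lemma sum_fin_two_arrow (F : (Fin 2 → Fin 2) → ℝ) :
    ∑ f, F f = F ![0, 0] + F ![0, 1] + F ![1, 0] + F ![1, 1] := by
  rw [← (finTwoArrowEquiv (Fin 2)).symm.sum_comp, Fintype.sum_prod_type]
  simp [Fin.sum_univ_two, finTwoArrowEquiv]
  ring

lemma isLocal_chshLocalPart : IsLocal chshLocalPart := by
  refine ⟨fun fg => if #{xy : Fin 2 × Fin 2 | fg.1 xy.1 + fg.2 xy.2 ≠ xy.1 * xy.2} = 1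
    then 1 / 8 else 0, fun fg => by positivity, ?_, fun a b x y => ?_⟩
  · simp [Fintype.sum_prod_type, sum_fin_two_arrow, Finset.card_filter, Fin.sum_univ_two]
    norm_num
  · fin_cases a <;> fin_cases b <;> fin_cases x <;> fin_cases y <;>
      simp [Fintype.sum_prod_type, sum_fin_two_arrow, Finset.card_filter, Fin.sum_univ_two,
        chshLocalPart, detLocal] <;> norm_num

lemma pCHSH_eq_mixture (a b x y : Fin 2) :
    pCHSH a b x y = (2 - √2) * chshLocalPart a b x y + (1 - (2 - √2)) * prBox a b x y := by
  have h : (√2)⁻¹ = √2 / 2 := by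
    rw [inv_eq_one_div, div_eq_div_iff (by positivity) (by norm_num)]
    simp
  simp only [pCHSH, chshLocalPart, prBox, div_eq_mul_inv _ √2, h]
  ring

/-- **Nonlocal content of the maximal CHSH violation is `√2 − 1`.** The correlation
`pCHSH` is no-signaling and its local content is `2 − √2` (equivalently, its nonlocal
content is `√2 − 1`). -/
theorem chsh_local_content :
    IsNSCorrelation pCHSH ∧ localContent pCHSH = 2 - Real.sqrt 2 := by
  have h1 : 1 ≤ √2 := Real.one_le_sqrt.2 (by norm_num)
  have h2 : √2 ≤ 2 := Real.sqrt_le_iff.2 (by norm_num)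
  refine ⟨isNSCorrelation_pCHSH, IsGreatest.csSup_eq ⟨⟨by linarith, by linarith, chshLocalPart,
    prBox, isLocal_chshLocalPart, isNSCorrelation_prBox, pCHSH_eq_mixture⟩, ?_⟩⟩
  rintro q ⟨hq0, hq1, pL, pNL, hL, hNL, hdec⟩
  have hmix : chshLoss pCHSH = q * chshLoss pL + (1 - q) * chshLoss pNL := by
    simp only [chshLoss, hdec]
    ring
  have hnonneg : 0 ≤ chshLoss pNL := by
    have := hNL.1.1
    unfold chshLoss
    linarith [this 0 1 0 0, this 1 0 0 0, this 0 1 0 1, this 1 0 0 1, this 0 1 1 0,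
      this 1 0 1 0, this 0 0 1 1, this 1 1 1 1]
  calc q ≤ q * chshLoss pL := le_mul_of_one_le_right hq0 hL.one_le_chshLoss
    _ ≤ chshLoss pCHSH := by
      rw [hmix]
      exact le_add_of_nonneg_right (mul_nonneg (by linarith) hnonneg)
    _ = 2 - √2 := chshLoss_pCHSH
end
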